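/- Let {X_n}_{n≥1} be a symmetric two-state correlated random walk on {1,-1} with parameter 0<p<1 (i.e., p=q), started from the stationary distribution (1/2,1/2). Let A,B be positive integers, S_n = X_1+···+X_n, τ = inf{k : S_k = A or S_k = -B}, and α = P(S_τ = A). Then α = (B - 1 + (1/2)·1/(1-p)) / (A + B - 2 + 1/(1-p)). -/

import Mathlib

open MeasureTheory ProbabilityTheory Set

noncomputable section

variable {Ω : Type*} [MeasurableSpace Ω]

/-- The σ-algebra `σ(X_1, …, X_n)` generated by the first `n` steps of the process. -/
def sigmaUpTo (X : ℕ → Ω → ℝ) (n : ℕ) : MeasurableSpace Ω :=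
  ⨆ i ∈ Finset.Icc 1 n, MeasurableSpace.comap (X i) inferInstance

/-- The transition kernel of a two-state correlated random walk on `{1, -1}`:
from state `1` go to `1` with probability `p`; from state `-1` go to `-1`
with probability `q`. -/
def crwKernel (p q : ℝ) (i j : ℝ) : ℝ :=
  if i = 1 then (if j = 1 then p else 1 - p)
  else (if j = -1 then q else 1 - q)

/-- `X` is a two-state correlated random walk on `{1, -1}` with parameters `p, q`,
started from the stationary distribution `((1-q)/(2-p-q), (1-p)/(2-p-q))`:
each `X n` (for `n ≥ 1`) is measurable with values in `{1, -1}`, the initial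
distribution is stationary, and the Markov property with the prescribed
time-homogeneous transition probabilities holds, conditionally on
`F n = σ(X_1, …, X_n)`. -/
def IsCRW (μ : Measure Ω) (X : ℕ → Ω → ℝ) (p q : ℝ) : Prop :=
  (∀ i, 1 ≤ i → Measurable (X i)) ∧
  (∀ n, 1 ≤ n → ∀ ω, X n ω = 1 ∨ X n ω = -1) ∧
  (μ {ω | X 1 ω = 1} = ENNReal.ofReal ((1 - q) / (2 - p - q))) ∧
  (∀ n, 1 ≤ n → ∀ i ∈ ({1, -1} : Set ℝ), ∀ j ∈ ({1, -1} : Set ℝ),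
    ∀ E : Set Ω, MeasurableSet[sigmaUpTo X n] E →
      μ (E ∩ {ω | X n ω = i ∧ X (n + 1) ω = j})
        = ENNReal.ofReal (crwKernel p q i j) * μ (E ∩ {ω | X n ω = i}))

/-- The event that the path `S` has hit neither `A` nor `-B` up to time `n`. -/
def survivalSet (S : ℕ → Ω → ℝ) (A B : ℕ) (n : ℕ) : Set Ω :=
  {ω | ∀ k ≤ n, S k ω ≠ (A : ℝ) ∧ S k ω ≠ -(B : ℝ)}

/-- The martingale `S n + (κ - 1) * X n` of the symmetric walk with correlation
`r = 1 - κ⁻¹`, stopped when leaving the sets `G n`, with time shifted by one. -/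
def stoppedWalk (X : ℕ → Ω → ℝ) (G : ℕ → Set Ω) (κ r : ℝ) : ℕ → Ω → ℝ
  | 0 => fun ω => κ * X 1 ω
  | n + 1 => fun ω => stoppedWalk X G κ r n ω +
      (G (n + 1)).indicator (fun ω => κ * (X (n + 2) ω - r * X (n + 1) ω)) ω

lemma measurable_sigmaUpTo (X : ℕ → Ω → ℝ) {i n : ℕ} (hi : 1 ≤ i) (hin : i ≤ n) :
    Measurable[sigmaUpTo X n] (X i) := by
  rw [measurable_iff_comap_le]
  exact le_iSup₂_of_le (f := fun i (_ : i ∈ Finset.Icc 1 n) =>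
    MeasurableSpace.comap (X i) inferInstance) i (Finset.mem_Icc.2 ⟨hi, hin⟩) le_rfl

lemma sigmaUpTo_mono (X : ℕ → Ω → ℝ) {m n : ℕ} (h : m ≤ n) :
    sigmaUpTo X m ≤ sigmaUpTo X n := by
  refine iSup₂_le fun i hi => ?_
  obtain ⟨h1, h2⟩ := Finset.mem_Icc.1 hi
  exact (measurable_sigmaUpTo X h1 (h2.trans h)).comap_le

lemma sigmaUpTo_le {X : ℕ → Ω → ℝ} (hX : ∀ i, 1 ≤ i → Measurable (X i)) (n : ℕ) :
    sigmaUpTo X n ≤ ‹MeasurableSpace Ω› :=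
  iSup₂_le fun i hi => (hX i (Finset.mem_Icc.1 hi).1).comap_le

lemma measurable_sum_sigmaUpTo {X S : ℕ → Ω → ℝ}
    (hS : ∀ n ω, S n ω = ∑ i ∈ Finset.Icc 1 n, X i ω) {k n : ℕ} (hkn : k ≤ n) :
    Measurable[sigmaUpTo X n] (S k) := by
  have : S k = fun ω => ∑ i ∈ Finset.Icc 1 k, X i ω := funext (hS k)
  rw [this]
  refine Finset.measurable_fun_sum _ fun i hi => ?_
  obtain ⟨h1, h2⟩ := Finset.mem_Icc.1 hi
  exact measurable_sigmaUpTo X h1 (h2.trans hkn)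

lemma measurableSet_survivalSet {X S : ℕ → Ω → ℝ}
    (hS : ∀ n ω, S n ω = ∑ i ∈ Finset.Icc 1 n, X i ω) (A B n : ℕ) :
    MeasurableSet[sigmaUpTo X n] (survivalSet S A B n) := by
  have : survivalSet S A B n =
      ⋂ k ∈ Finset.Iic n, (S k ⁻¹' {(A : ℝ)})ᶜ ∩ (S k ⁻¹' {-(B : ℝ)})ᶜ := by
    ext ω; simp [survivalSet]
  rw [this]
  refine Finset.measurableSet_biInter _ fun k hk => ?_
  have hm := measurable_sum_sigmaUpTo hS (Finset.mem_Iic.1 hk)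
  exact (hm (measurableSet_singleton _)).compl.inter (hm (measurableSet_singleton _)).compl

lemma measurable_stoppedWalk {X : ℕ → Ω → ℝ} {G : ℕ → Set Ω} (κ r : ℝ)
    (hG : ∀ n, MeasurableSet[sigmaUpTo X n] (G n)) (n : ℕ) :
    Measurable[sigmaUpTo X (n + 1)] (stoppedWalk X G κ r n) := by
  induction n with
  | zero => exact (measurable_sigmaUpTo X le_rfl le_rfl).const_mul κ
  | succ n ih =>
    refine Measurable.add (ih.mono (sigmaUpTo_mono X (by omega)) le_rfl) ?_
    refine Measurable.indicator ?_ (sigmaUpTo_mono X (by omega) _ (hG (n + 1)))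
    exact ((measurable_sigmaUpTo X (by omega) (by omega)).sub
      ((measurable_sigmaUpTo X (by omega) (by omega)).const_mul r)).const_mul κ

lemma exists_int_eq_sum {X S : ℕ → Ω → ℝ} (hX : ∀ n, 1 ≤ n → ∀ ω, X n ω = 1 ∨ X n ω = -1)
    (hS : ∀ n ω, S n ω = ∑ i ∈ Finset.Icc 1 n, X i ω) (n : ℕ) (ω : Ω) :
    ∃ s : ℤ, S n ω = s := by
  induction n with
  | zero => exact ⟨0, by simp [hS]⟩
  | succ n ih =>
    obtain ⟨s, hs⟩ := ih
    rw [hS, Finset.sum_Icc_succ_top (by omega), ← hS, hs]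
    rcases hX (n + 1) (by omega) ω with h | h
    · exact ⟨s + 1, by simp [h]⟩
    · exact ⟨s - 1, by simp [h, sub_eq_add_neg]⟩

/-- One step of the walk from inside the interval `(-B, A)`: it stays inside, or exits
exactly at `A` by an up-step, or exits exactly at `-B` by a down-step. -/
lemma survivalSet_step {X S : ℕ → Ω → ℝ} (hX : ∀ n, 1 ≤ n → ∀ ω, X n ω = 1 ∨ X n ω = -1)
    (hS : ∀ n ω, S n ω = ∑ i ∈ Finset.Icc 1 n, X i ω) {A B : ℕ}
    {τ : Ω → ℕ} (hτ : ∀ ω, τ ω = sInf {k | S k ω = (A : ℝ) ∨ S k ω = -(B : ℝ)})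
    {n : ℕ} {ω : Ω} (hG : ω ∈ survivalSet S A B n)
    (hlow : -(B : ℝ) < S n ω) (hup : S n ω < A) :
    (ω ∈ survivalSet S A B (n + 1) ∧ -(B : ℝ) < S (n + 1) ω ∧ S (n + 1) ω < A) ∨
    (ω ∉ survivalSet S A B (n + 1) ∧ S (τ ω) ω = A ∧ S (n + 1) ω = A ∧ X (n + 1) ω = 1) ∨
    (ω ∉ survivalSet S A B (n + 1) ∧ S (τ ω) ω = -B ∧ S (n + 1) ω = -B ∧
      X (n + 1) ω = -1) := by
  obtain ⟨s, hs⟩ := exists_int_eq_sum hX hS n ω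
  have hstep : S (n + 1) ω = S n ω + X (n + 1) ω := by
    rw [hS, Finset.sum_Icc_succ_top (by omega), ← hS]
  have hs1 : -(B : ℤ) < s := by rw [hs] at hlow; exact_mod_cast hlow
  have hs2 : s < (A : ℤ) := by rw [hs] at hup; exact_mod_cast hup
  have hhit : S (n + 1) ω = A ∨ S (n + 1) ω = -B →
      τ ω = n + 1 ∧ ω ∉ survivalSet S A B (n + 1) := by
    intro h
    refine ⟨?_, fun hmem => ?_⟩
    · rw [hτ]
      refine le_antisymm (Nat.sInf_le h) (le_csInf ⟨_, h⟩ fun k hk => ?_)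
      by_contra! hlt
      have := hG k (by omega)
      rcases hk with hk | hk
      · exact this.1 hk
      · exact this.2 hk
    · have := hmem (n + 1) le_rfl
      tauto
  have hstay : S (n + 1) ω ≠ A → S (n + 1) ω ≠ -B → ω ∈ survivalSet S A B (n + 1) := by
    intro h1 h2 k hk
    rcases Nat.le_succ_iff.1 hk with h | rfl
    · exact hG k h
    · exact ⟨h1, h2⟩
  rcases hX (n + 1) (by omega) ω with h | h
  · have hc : S (n + 1) ω = ((s + 1 : ℤ) : ℝ) := by rw [hstep, hs, h]; push_cast; ring
    by_cases hA : S (n + 1) ω = A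
    · obtain ⟨h1, h2⟩ := hhit (Or.inl hA)
      exact Or.inr (Or.inl ⟨h2, by rw [h1, hA], hA, h⟩)
    · have hne : s + 1 ≠ (A : ℤ) := fun h => hA (by rw [hc, h]; simp)
      have hl : -(B : ℝ) < S (n + 1) ω := by
        rw [hc]; exact_mod_cast (by omega : -(B : ℤ) < s + 1)
      have hu : S (n + 1) ω < A := by
        rw [hc]; exact_mod_cast (by omega : s + 1 < (A : ℤ))
      exact Or.inl ⟨hstay hA hl.ne', hl, hu⟩
  · have hc : S (n + 1) ω = ((s - 1 : ℤ) : ℝ) := by rw [hstep, hs, h]; push_cast; ring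
    by_cases hB : S (n + 1) ω = -B
    · obtain ⟨h1, h2⟩ := hhit (Or.inr hB)
      exact Or.inr (Or.inr ⟨h2, by rw [h1, hB], hB, h⟩)
    · have hne : s - 1 ≠ -(B : ℤ) := fun h => hB (by rw [hc, h]; simp)
      have hl : -(B : ℝ) < S (n + 1) ω := by
        rw [hc]; exact_mod_cast (by omega : -(B : ℤ) < s - 1)
      have hu : S (n + 1) ω < A := by
        rw [hc]; exact_mod_cast (by omega : s - 1 < (A : ℤ))
      exact Or.inl ⟨hstay hu.ne hB, hl, hu⟩

lemma stoppedWalk_cases {X S : ℕ → Ω → ℝ} (hX : ∀ n, 1 ≤ n → ∀ ω, X n ω = 1 ∨ X n ω = -1)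
    (hS : ∀ n ω, S n ω = ∑ i ∈ Finset.Icc 1 n, X i ω) {A B : ℕ} (hA : 0 < A) (hB : 0 < B)
    {τ : Ω → ℕ} (hτ : ∀ ω, τ ω = sInf {k | S k ω = (A : ℝ) ∨ S k ω = -(B : ℝ)})
    {κ r : ℝ} (hκ : κ * (1 - r) = 1) (n : ℕ) (ω : Ω) :
    (ω ∈ survivalSet S A B (n + 1) ∧ -(B : ℝ) < S (n + 1) ω ∧ S (n + 1) ω < A ∧
      stoppedWalk X (survivalSet S A B) κ r n ω = S (n + 1) ω + (κ - 1) * X (n + 1) ω) ∨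
    (ω ∉ survivalSet S A B (n + 1) ∧ S (τ ω) ω = A ∧
      stoppedWalk X (survivalSet S A B) κ r n ω = A + (κ - 1)) ∨
    (ω ∉ survivalSet S A B (n + 1) ∧ S (τ ω) ω = -B ∧
      stoppedWalk X (survivalSet S A B) κ r n ω = -(B + (κ - 1))) := by
  have hA' : (0 : ℝ) < A := by exact_mod_cast hA
  have hB' : (0 : ℝ) < B := by exact_mod_cast hB
  have hstep : ∀ n, S (n + 1) ω = S n ω + X (n + 1) ω := fun n => by
    rw [hS, Finset.sum_Icc_succ_top (by omega), ← hS]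
  have h0 : S 0 ω = 0 := by simp [hS]
  induction n with
  | zero =>
    have hY : stoppedWalk X (survivalSet S A B) κ r 0 ω = S 1 ω + (κ - 1) * X 1 ω := by
      rw [hstep 0, h0]; simp only [stoppedWalk]; ring
    have hmem : ω ∈ survivalSet S A B 0 := by
      intro k hk
      obtain rfl : k = 0 := by omega
      rw [h0]
      exact ⟨hA'.ne, (neg_neg_of_pos hB').ne'⟩
    rcases survivalSet_step hX hS hτ hmem (by rw [h0]; linarith) (by rw [h0]; exact hA') with
      ⟨h1, h2, h3⟩ | ⟨h1, h2, h3, h4⟩ | ⟨h1, h2, h3, h4⟩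
    · exact Or.inl ⟨h1, h2, h3, hY⟩
    · exact Or.inr (Or.inl ⟨h1, h2, by rw [hY, h3, h4]; ring⟩)
    · exact Or.inr (Or.inr ⟨h1, h2, by rw [hY, h3, h4]; ring⟩)
  | succ n ih =>
    have hanti : ω ∉ survivalSet S A B (n + 1) → ω ∉ survivalSet S A B (n + 2) :=
      fun h h' => h fun k hk => h' k (by omega)
    rcases ih with ⟨g1, g2, g3, g4⟩ | ⟨g1, g2, g3⟩ | ⟨g1, g2, g3⟩
    · have hY : stoppedWalk X (survivalSet S A B) κ r (n + 1) ω =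
          S (n + 2) ω + (κ - 1) * X (n + 2) ω := by
        simp only [stoppedWalk, Set.indicator_of_mem g1]
        rw [g4, hstep (n + 1)]
        linear_combination X (n + 1) ω * hκ
      rcases survivalSet_step hX hS hτ g1 g2 g3 with
        ⟨h1, h2, h3⟩ | ⟨h1, h2, h3, h4⟩ | ⟨h1, h2, h3, h4⟩
      · exact Or.inl ⟨h1, h2, h3, hY⟩
      · exact Or.inr (Or.inl ⟨h1, h2, by rw [hY, h3, h4]; ring⟩)
      · exact Or.inr (Or.inr ⟨h1, h2, by rw [hY, h3, h4]; ring⟩)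
    · refine Or.inr (Or.inl ⟨hanti g1, g2, ?_⟩)
      simp only [stoppedWalk, Set.indicator_of_notMem g1, g3, add_zero]
    · refine Or.inr (Or.inr ⟨hanti g1, g2, ?_⟩)
      simp only [stoppedWalk, Set.indicator_of_notMem g1, g3, add_zero]

lemma setIntegral_eq_measureReal_sub {μ : Measure Ω} [IsFiniteMeasure μ] {f : Ω → ℝ}
    (hf : Measurable f) (hval : ∀ ω, f ω = 1 ∨ f ω = -1) (E : Set Ω) :
    ∫ ω in E, f ω ∂μ = μ.real (E ∩ {ω | f ω = 1}) - μ.real (E ∩ {ω | f ω = -1}) := by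
  have hm : ∀ a : ℝ, MeasurableSet {ω | f ω = a} := fun a => hf (measurableSet_singleton a)
  have hfeq : f = fun ω => {ω | f ω = 1}.indicator 1 ω - {ω | f ω = -1}.indicator 1 ω := by
    funext ω
    rcases hval ω with h | h <;> norm_num [Set.indicator, h]
  conv_lhs => rw [hfeq]
  rw [integral_sub, integral_indicator_one (hm 1), integral_indicator_one (hm (-1)),
    measureReal_restrict_apply (hm 1), measureReal_restrict_apply (hm (-1)),
    Set.inter_comm E, Set.inter_comm E]
  · exact (integrable_const (1 : ℝ)).indicator (hm 1)
  · exact (integrable_const (1 : ℝ)).indicator (hm (-1))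

lemma IsCRW.setIntegral_succ {μ : Measure Ω} [IsProbabilityMeasure μ] {X : ℕ → Ω → ℝ} {p : ℝ}
    (hp0 : 0 < p) (hp1 : p < 1) (hX : IsCRW μ X p p) {n : ℕ} (hn : 1 ≤ n) {E : Set Ω}
    (hE : MeasurableSet[sigmaUpTo X n] E) :
    ∫ ω in E, X (n + 1) ω ∂μ = (2 * p - 1) * ∫ ω in E, X n ω ∂μ := by
  obtain ⟨hmeas, hval, -, htrans⟩ := hX
  have hEm := sigmaUpTo_le hmeas n _ hE
  rw [setIntegral_eq_measureReal_sub (hmeas _ (by omega)) (hval _ (by omega)) E,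
    setIntegral_eq_measureReal_sub (hmeas _ hn) (hval _ hn) E]
  have hker : ∀ i ∈ ({1, -1} : Set ℝ), ∀ j ∈ ({1, -1} : Set ℝ), 0 ≤ crwKernel p p i j := by
    intro i _ j _
    unfold crwKernel
    split_ifs <;> linarith
  have hreal : ∀ i ∈ ({1, -1} : Set ℝ), ∀ j ∈ ({1, -1} : Set ℝ),
      μ.real (E ∩ {ω | X n ω = i ∧ X (n + 1) ω = j}) =
        crwKernel p p i j * μ.real (E ∩ {ω | X n ω = i}) := by
    intro i hi j hj
    rw [measureReal_def, htrans n hn i hi j hj E hE, ENNReal.toReal_mul,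
      ENNReal.toReal_ofReal (hker i hi j hj), measureReal_def]
  have hsplit : ∀ j : ℝ, μ.real (E ∩ {ω | X (n + 1) ω = j}) =
      μ.real (E ∩ {ω | X n ω = 1 ∧ X (n + 1) ω = j}) +
        μ.real (E ∩ {ω | X n ω = -1 ∧ X (n + 1) ω = j}) := by
    intro j
    rw [← measureReal_union]
    · congr 1
      ext ω
      have := hval n hn ω
      simp only [Set.mem_inter_iff, Set.mem_union, Set.mem_ofPred_eq]
      tauto
    · rw [Set.disjoint_left]
      rintro ω ⟨-, h1, -⟩ ⟨-, h2, -⟩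
      rw [h1] at h2
      norm_num at h2
    · exact hEm.inter ((hmeas n hn (measurableSet_singleton _)).inter
        (hmeas (n + 1) (by omega) (measurableSet_singleton _)))
  rw [hsplit 1, hsplit (-1), hreal 1 (by simp) 1 (by simp), hreal 1 (by simp) (-1) (by simp),
    hreal (-1) (by simp) 1 (by simp), hreal (-1) (by simp) (-1) (by simp)]
  norm_num [crwKernel]
  ring

lemma IsCRW.integrable {μ : Measure Ω} [IsProbabilityMeasure μ] {X : ℕ → Ω → ℝ} {p : ℝ}
    (hX : IsCRW μ X p p) {n : ℕ} (hn : 1 ≤ n) : Integrable (X n) μ := by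
  refine Integrable.of_bound (hX.1 n hn).aestronglyMeasurable 1 (ae_of_all _ fun ω => ?_)
  rcases hX.2.1 n hn ω with h | h <;> simp [h]

lemma IsCRW.condExp_succ {μ : Measure Ω} [IsProbabilityMeasure μ] {X : ℕ → Ω → ℝ} {p : ℝ}
    (hp0 : 0 < p) (hp1 : p < 1) (hX : IsCRW μ X p p) {n : ℕ} (hn : 1 ≤ n) :
    (fun ω => (2 * p - 1) * X n ω) =ᵐ[μ] μ[X (n + 1)|sigmaUpTo X n] := by
  refine ae_eq_condExp_of_forall_setIntegral_eq (sigmaUpTo_le hX.1 n)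
    (hX.integrable (by omega)) (fun s _ _ => ((hX.integrable hn).const_mul _).integrableOn)
    (fun s hs _ => ?_) ?_
  · rw [integral_const_mul, hX.setIntegral_succ hp0 hp1 hn hs]
  · exact ((measurable_sigmaUpTo X hn le_rfl).const_mul _).stronglyMeasurable.aestronglyMeasurable

/-- The centred increments of a symmetric correlated random walk are orthogonal to the past. -/
lemma IsCRW.integral_mul_increment {μ : Measure Ω} [IsProbabilityMeasure μ] {X : ℕ → Ω → ℝ}
    {p : ℝ} (hp0 : 0 < p) (hp1 : p < 1) (hX : IsCRW μ X p p) {n : ℕ} (hn : 1 ≤ n)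
    {Z : Ω → ℝ} (hZ : Measurable[sigmaUpTo X n] Z) {C : ℝ} (hC : ∀ ω, |Z ω| ≤ C) :
    ∫ ω, Z ω * (X (n + 1) ω - (2 * p - 1) * X n ω) ∂μ = 0 := by
  have hle := sigmaUpTo_le hX.1 n
  have hZ' : AEStronglyMeasurable Z μ := (hZ.mono hle le_rfl).aestronglyMeasurable
  have hint : ∀ m, 1 ≤ m → Integrable (fun ω => Z ω * X m ω) μ := fun m hm =>
    (hX.integrable hm).bdd_mul hZ' (ae_of_all _ hC)
  have h1 : ∫ ω, Z ω * X (n + 1) ω ∂μ = ∫ ω, Z ω * ((2 * p - 1) * X n ω) ∂μ := by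
    rw [← integral_condExp hle]
    refine integral_congr_ae ?_
    filter_upwards [condExp_mul_of_stronglyMeasurable_left hZ.stronglyMeasurable
      (hint (n + 1) (by omega)) (hX.integrable (by omega)),
      hX.condExp_succ hp0 hp1 hn] with ω h1 h2
    rw [h2]
    exact h1
  have h2 : Integrable (fun ω => Z ω * ((2 * p - 1) * X n ω)) μ := by
    refine ((hint n hn).const_mul (2 * p - 1)).congr (ae_of_all _ fun ω => ?_)
    ring
  simp only [mul_sub]
  rw [integral_sub (hint _ (by omega)) h2, h1, sub_self]

lemma IsCRW.integral_one {μ : Measure Ω} [IsProbabilityMeasure μ] {X : ℕ → Ω → ℝ} {p : ℝ}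
    (hp1 : p < 1) (hX : IsCRW μ X p p) : ∫ ω, X 1 ω ∂μ = 0 := by
  have hm := hX.1 1 le_rfl
  have hone : μ.real {ω | X 1 ω = 1} = 1 / 2 := by
    rw [measureReal_def, hX.2.2.1, ENNReal.toReal_ofReal]
    · rw [div_eq_div_iff] <;> linarith
    · exact div_nonneg (by linarith) (by linarith)
  have hcompl : {ω | X 1 ω = -1} = {ω | X 1 ω = 1}ᶜ := by
    ext ω
    rcases hX.2.1 1 le_rfl ω with h | h <;> norm_num [h]
  have h := setIntegral_eq_measureReal_sub (μ := μ) hm (hX.2.1 1 le_rfl) Set.univ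
  rw [setIntegral_univ, Set.univ_inter, Set.univ_inter, hcompl,
    probReal_compl_eq_one_sub (s := {ω | X 1 ω = 1}) (hm (measurableSet_singleton 1)), hone] at h
  rw [h]; norm_num

section StoppedMoments

variable {μ : Measure Ω} [IsProbabilityMeasure μ] {X : ℕ → Ω → ℝ} {p : ℝ}
  {G : ℕ → Set Ω} {κ C : ℝ}

lemma integrable_stoppedWalk_of_bounded (hX : IsCRW μ X p p)
    (hG : ∀ n, MeasurableSet[sigmaUpTo X n] (G n))
    (hC : ∀ n ω, |stoppedWalk X G κ (2 * p - 1) n ω| ≤ C) (n : ℕ) :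
    Integrable (stoppedWalk X G κ (2 * p - 1) n) μ :=
  .of_bound ((measurable_stoppedWalk κ _ hG n).mono (sigmaUpTo_le hX.1 _)
    le_rfl).aestronglyMeasurable C (ae_of_all _ (hC n))

lemma integral_stoppedWalk (hp0 : 0 < p) (hp1 : p < 1) (hX : IsCRW μ X p p)
    (hG : ∀ n, MeasurableSet[sigmaUpTo X n] (G n))
    (hC : ∀ n ω, |stoppedWalk X G κ (2 * p - 1) n ω| ≤ C) (n : ℕ) :
    ∫ ω, stoppedWalk X G κ (2 * p - 1) n ω ∂μ = 0 := by
  induction n with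
  | zero =>
    simp only [stoppedWalk]
    rw [integral_const_mul, hX.integral_one hp1, mul_zero]
  | succ n ih =>
    have hI := integrable_stoppedWalk_of_bounded hX hG hC
    have horth := hX.integral_mul_increment hp0 hp1 (n := n + 1) (by omega)
      (Z := (G (n + 1)).indicator fun _ => κ) (measurable_const.indicator (hG (n + 1)))
      (C := |κ|) (fun ω => by
        by_cases h : ω ∈ G (n + 1) <;> simp [h])
    rw [← sub_zero (∫ ω, stoppedWalk X G κ (2 * p - 1) (n + 1) ω ∂μ), ← ih,
      ← integral_sub (hI _) (hI _), ih, ← horth]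
    refine integral_congr_ae (ae_of_all _ fun ω => ?_)
    by_cases h : ω ∈ G (n + 1) <;> simp [stoppedWalk, h]

lemma integral_sq_stoppedWalk_succ (hp0 : 0 < p) (hp1 : p < 1) (hX : IsCRW μ X p p)
    (hG : ∀ n, MeasurableSet[sigmaUpTo X n] (G n))
    (hC : ∀ n ω, |stoppedWalk X G κ (2 * p - 1) n ω| ≤ C) (n : ℕ) :
    ∫ ω, stoppedWalk X G κ (2 * p - 1) (n + 1) ω ^ 2 ∂μ =
      ∫ ω, stoppedWalk X G κ (2 * p - 1) n ω ^ 2 ∂μ +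
        κ ^ 2 * (1 - (2 * p - 1) ^ 2) * μ.real (G (n + 1)) := by
  set r := 2 * p - 1 with hr
  set Y := stoppedWalk X G κ r with hY
  have hle := sigmaUpTo_le hX.1
  have hGm := hle _ _ (hG (n + 1))
  have hXn : Measurable[sigmaUpTo X (n + 1)] (X (n + 1)) :=
    measurable_sigmaUpTo X (by omega) le_rfl
  set W : Ω → ℝ := fun ω => 2 * κ * Y n ω - 2 * r * κ ^ 2 * X (n + 1) ω with hW
  have hWm : Measurable[sigmaUpTo X (n + 1)] W :=
    ((measurable_stoppedWalk κ r hG n).const_mul _).sub (hXn.const_mul _)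
  have hWC : ∀ ω, |W ω| ≤ |2 * κ| * C + |2 * r * κ ^ 2| := by
    intro ω
    refine (abs_sub _ _).trans ?_
    rw [abs_mul _ (Y n ω), abs_mul _ (X (n + 1) ω)]
    have h1 : |X (n + 1) ω| = 1 := by
      rcases hX.2.1 (n + 1) (by omega) ω with h | h <;> simp [h]
    rw [h1, mul_one]
    gcongr
    exact hC n ω
  set Z := (G (n + 1)).indicator W with hZ
  have hZm : Measurable[sigmaUpTo X (n + 1)] Z := hWm.indicator (hG (n + 1))
  have hZC : ∀ ω, |Z ω| ≤ |2 * κ| * C + |2 * r * κ ^ 2| := fun ω =>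
    (norm_indicator_le_norm_self W ω).trans (hWC ω)
  have horth := hX.integral_mul_increment hp0 hp1 (n := n + 1) (by omega) hZm hZC
  have hsq : Integrable (fun ω => Y n ω ^ 2) μ := by
    refine .of_bound (((measurable_stoppedWalk κ r hG n).mono (hle _)
      le_rfl).pow_const 2).aestronglyMeasurable (C ^ 2) (ae_of_all _ fun ω => ?_)
    rw [Real.norm_eq_abs, abs_pow]
    gcongr
    exact hC n ω
  have hind : Integrable (fun ω => κ ^ 2 * (1 - r ^ 2) * (G (n + 1)).indicator 1 ω) μ :=
    ((integrable_const (1 : ℝ)).indicator hGm).const_mul _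
  have hinc : Integrable (fun ω => Z ω * (X (n + 1 + 1) ω - r * X (n + 1) ω)) μ :=
    ((hX.integrable (by omega)).sub ((hX.integrable (by omega)).const_mul r)).bdd_mul
      (hZm.mono (hle _) le_rfl).aestronglyMeasurable (ae_of_all _ hZC)
  have hpt : ∀ ω, Y (n + 1) ω ^ 2 = Y n ω ^ 2 +
      κ ^ 2 * (1 - r ^ 2) * (G (n + 1)).indicator 1 ω +
      Z ω * (X (n + 1 + 1) ω - r * X (n + 1) ω) := by
    intro ω
    by_cases h : ω ∈ G (n + 1)
    · simp only [hY, hZ, hW, stoppedWalk, Set.indicator_of_mem h, Pi.one_apply]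
      have h1 : X (n + 1) ω ^ 2 = 1 := by
        rcases hX.2.1 (n + 1) (by omega) ω with h | h <;> simp [h]
      have h2 : X (n + 1 + 1) ω ^ 2 = 1 := by
        rcases hX.2.1 (n + 1 + 1) (by omega) ω with h | h <;> simp [h]
      linear_combination κ ^ 2 * h2 - κ ^ 2 * r ^ 2 * h1
    · simp [hY, hZ, stoppedWalk, h]
  simp only [hpt]
  rw [integral_add (by exact hsq.add hind) hinc, horth, integral_add hsq hind, integral_const_mul,
    integral_indicator_one hGm, add_zero]

/-- If the stopped walk is bounded, then the walk is eventually stopped almost surely. -/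
lemma tendsto_measureReal_of_bounded_stoppedWalk (hp0 : 0 < p) (hp1 : p < 1)
    (hX : IsCRW μ X p p) (hG : ∀ n, MeasurableSet[sigmaUpTo X n] (G n)) (hκ : κ ≠ 0)
    (hC : ∀ n ω, |stoppedWalk X G κ (2 * p - 1) n ω| ≤ C) :
    Filter.Tendsto (fun n => μ.real (G (n + 1))) Filter.atTop (nhds 0) := by
  have hv : 0 < κ ^ 2 * (1 - (2 * p - 1) ^ 2) := by
    have : 0 < 1 - (2 * p - 1) ^ 2 := by nlinarith
    positivity
  set v := κ ^ 2 * (1 - (2 * p - 1) ^ 2) with hv_def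
  set a : ℕ → ℝ := fun n => ∫ ω, stoppedWalk X G κ (2 * p - 1) n ω ^ 2 ∂μ with ha
  have hsucc : ∀ n, a (n + 1) = a n + v * μ.real (G (n + 1)) :=
    integral_sq_stoppedWalk_succ hp0 hp1 hX hG hC
  have hmono : Monotone a := monotone_nat_of_le_succ fun n => by
    rw [hsucc]; have := measureReal_nonneg (μ := μ) (s := G (n + 1)); nlinarith
  have hbdd : BddAbove (Set.range a) := by
    refine ⟨C ^ 2, ?_⟩
    rintro _ ⟨n, rfl⟩
    refine (integral_mono_of_nonneg (ae_of_all _ fun ω => sq_nonneg _)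
      (integrable_const (C ^ 2)) (ae_of_all _ fun ω => ?_)).trans (by simp)
    exact sq_le_sq.2 ((hC n ω).trans (le_abs_self C))
  have hlim := tendsto_atTop_ciSup hmono hbdd
  have hdiff := (((Filter.tendsto_add_atTop_iff_nat 1).2 hlim).sub hlim).const_mul v⁻¹
  rw [sub_self, mul_zero] at hdiff
  refine hdiff.congr fun n => ?_
  rw [hsucc]
  field_simp
  ring

end StoppedMoments

lemma measurableSet_exit_top {X S : ℕ → Ω → ℝ} (hX : ∀ i, 1 ≤ i → Measurable (X i))
    (hS : ∀ n ω, S n ω = ∑ i ∈ Finset.Icc 1 n, X i ω) {A B : ℕ} (hA : 0 < A) {τ : Ω → ℕ}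
    (hτ : ∀ ω, τ ω = sInf {k | S k ω = (A : ℝ) ∨ S k ω = -(B : ℝ)}) :
    MeasurableSet {ω | S (τ ω) ω = (A : ℝ)} := by
  have hA' : (0 : ℝ) < A := by exact_mod_cast hA
  have heq : {ω | S (τ ω) ω = (A : ℝ)} =
      ⋃ n, survivalSet S A B n ∩ S (n + 1) ⁻¹' {(A : ℝ)} := by
    ext ω
    simp only [Set.mem_ofPred_eq, Set.mem_iUnion, Set.mem_inter_iff, Set.mem_preimage,
      Set.mem_singleton_iff]
    constructor
    · intro h
      obtain ⟨m, hm⟩ : ∃ m, τ ω = m + 1 := by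
        refine Nat.exists_eq_succ_of_ne_zero fun h0 => ?_
        rw [h0, hS] at h
        simp only [zero_lt_one, Finset.Icc_eq_empty_of_lt, Finset.sum_empty] at h
        exact hA'.ne h
      refine ⟨m, fun k hk => ?_, hm ▸ h⟩
      have := Nat.notMem_of_lt_sInf (m := k) (by rw [← hτ ω]; omega)
      simpa [not_or] using this
    · rintro ⟨n, hn, h⟩
      suffices τ ω = n + 1 by rw [this, h]
      rw [hτ]
      refine le_antisymm (Nat.sInf_le (Or.inl h)) (le_csInf ⟨_, Or.inl h⟩ fun k hk => ?_)
      by_contra! hlt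
      have := hn k (by omega)
      rcases hk with hk | hk
      · exact this.1 hk
      · exact this.2 hk
  rw [heq]
  refine MeasurableSet.iUnion fun n => MeasurableSet.inter ?_ ?_
  · exact sigmaUpTo_le hX n _ (measurableSet_survivalSet hS A B n)
  · exact ((measurable_sum_sigmaUpTo hS le_rfl).mono (sigmaUpTo_le hX _) le_rfl)
      (measurableSet_singleton _)

/-- Ruin probability for the symmetric two-state CRW (`p = q`), started from
the stationary distribution `(1/2, 1/2)`: with `τ = inf{k : S_k = A or S_k = -B}`,
`α = P(S_τ = A) = (B - 1 + (1/2)·1/(1-p)) / (A + B - 2 + 1/(1-p))`. -/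
theorem crw_symmetric_ruin_probability
    (μ : Measure Ω) [IsProbabilityMeasure μ] (X : ℕ → Ω → ℝ) (p : ℝ)
    (hp0 : 0 < p) (hp1 : p < 1) (hX : IsCRW μ X p p)
    (A B : ℕ) (hA : 0 < A) (hB : 0 < B)
    (S : ℕ → Ω → ℝ) (hS : ∀ n ω, S n ω = ∑ i ∈ Finset.Icc 1 n, X i ω)
    (τ : Ω → ℕ)
    (hτ : ∀ ω, τ ω = sInf {k | S k ω = (A : ℝ) ∨ S k ω = -(B : ℝ)}) :
    (μ {ω | S (τ ω) ω = (A : ℝ)}).toReal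
      = ((B : ℝ) - 1 + (1 / 2) * (1 / (1 - p)))
        / ((A : ℝ) + (B : ℝ) - 2 + 1 / (1 - p)) := by
  have hval := hX.2.1
  set r := 2 * p - 1 with hr
  set κ := 1 / (2 * (1 - p)) with hκ_def
  have hq : 0 < 1 - p := by linarith
  have hκ0 : 0 < κ := by positivity
  have hκ : κ * (1 - r) = 1 := by rw [hκ_def, hr]; field_simp; ring
  set G := survivalSet S A B
  have hG : ∀ n, MeasurableSet[sigmaUpTo X n] (G n) := measurableSet_survivalSet hS A B
  set Y := stoppedWalk X G κ r
  have hcases := stoppedWalk_cases hval hS hA hB hτ hκ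
  have hA' : (1 : ℝ) ≤ A := by exact_mod_cast hA
  have hB' : (1 : ℝ) ≤ B := by exact_mod_cast hB
  set C : ℝ := A + B + |κ - 1| with hC_def
  have hC : ∀ n ω, |Y n ω| ≤ C := by
    intro n ω
    have h1 := neg_abs_le (κ - 1)
    have h2 := le_abs_self (κ - 1)
    rw [abs_le]
    rcases hcases n ω with ⟨-, g2, g3, g4⟩ | ⟨-, -, g3⟩ | ⟨-, -, g3⟩
    · rcases hval (n + 1) (by omega) ω with h | h <;> rw [h] at g4 <;>
        constructor <;> linarith
    · constructor <;> linarith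
    · constructor <;> linarith
  set H : Set Ω := {ω | S (τ ω) ω = (A : ℝ)}
  have hHm : MeasurableSet H := measurableSet_exit_top hX.1 hS hA hτ
  have hpt : ∀ n ω, ‖Y n ω - ((A + B + 2 * (κ - 1)) * H.indicator 1 ω - (B + (κ - 1)))‖ ≤
      (2 * C) * (G (n + 1)).indicator 1 ω := by
    intro n ω
    rcases hcases n ω with ⟨g1, -⟩ | ⟨g1, g2, g3⟩ | ⟨g1, g2, g3⟩
    · have h1 := abs_le.1 (hC n ω)
      have h2 := neg_abs_le (κ - 1)
      have h3 := le_abs_self (κ - 1)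
      rw [Set.indicator_of_mem g1, Real.norm_eq_abs, abs_le]
      by_cases h : ω ∈ H <;> simp only [h, Set.indicator_of_mem, Set.indicator_of_notMem,
        not_false_eq_true, Pi.one_apply] <;> constructor <;> linarith
    · have h : ω ∈ H := g2
      rw [Set.indicator_of_notMem g1, Set.indicator_of_mem h, show Y n ω = _ from g3,
        Pi.one_apply]
      ring_nf
      simp
    · have h : ω ∉ H := fun h => by
        have : S (τ ω) ω = A := h
        linarith
      rw [Set.indicator_of_notMem g1, Set.indicator_of_notMem h, show Y n ω = _ from g3]
      ring_nf
      simp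
  have hIH : Integrable (fun ω => (A + B + 2 * (κ - 1)) * H.indicator (1 : Ω → ℝ) ω) μ :=
    ((integrable_const (1 : ℝ)).indicator hHm).const_mul _
  have hGm : ∀ n, MeasurableSet (G n) := fun n => sigmaUpTo_le hX.1 n _ (hG n)
  have hbound : ∀ n, ‖(A + B + 2 * (κ - 1)) * μ.real H - (B + (κ - 1))‖ ≤
      (2 * C) * μ.real (G (n + 1)) := by
    intro n
    have h := norm_integral_le_of_norm_le
      (((integrable_const (1 : ℝ)).indicator (hGm (n + 1))).const_mul (2 * C))
      (ae_of_all μ (hpt n))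
    rw [integral_sub (integrable_stoppedWalk_of_bounded hX hG hC n)
        (by exact hIH.sub (integrable_const _)),
      integral_sub hIH (integrable_const _), integral_stoppedWalk hp0 hp1 hX hG hC n,
      integral_const_mul, integral_indicator_one hHm, zero_sub, norm_neg, integral_const,
      probReal_univ, one_smul, integral_const_mul] at h
    exact h.trans_eq (congrArg _ (integral_indicator_one (hGm (n + 1))))
  have hlim := (tendsto_measureReal_of_bounded_stoppedWalk hp0 hp1 hX hG hκ0.ne' hC).const_mul
    (2 * C)
  rw [mul_zero] at hlim
  have hzero := norm_le_zero_iff.1 (ge_of_tendsto' hlim hbound)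
  have hden : (A : ℝ) + B - 2 + 1 / (1 - p) = A + B + 2 * (κ - 1) := by
    rw [hκ_def]; field_simp; ring
  have hnum : (B : ℝ) - 1 + 1 / 2 * (1 / (1 - p)) = B + (κ - 1) := by
    rw [hκ_def]; field_simp; ring
  rw [hden, hnum, eq_div_iff (by linarith), ← measureReal_def]
  linarith
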